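/- Fix α ∈ (0,1). For every ε > 0 there exist constants K > 0 and β₀ > 0 such that for all β ∈ (0, β₀) and all integers n > m: 0 ≤ E_n − H(D_1 | X^n, y(X^n,D^n), D_0, D_{n+1}, T=1)·P(T=1) ≤ K β^{2−ε}; consequently E_∞ = lim_{n→∞} H(D_1 | X^n, y(X^n,D^n), D_0, D_{n+1}, T=1)·P(T=1) + O(β^{2−ε}). -/

import Mathlib

open Filter

noncomputable section

open scoped Classical

namespace SyncDeletion

/-- The deletion output `y(x, d)`: the subsequence of `x` consisting of the bits `x i`
with `d i = false`, in order. -/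
def yList (x d : List Bool) : List Bool :=
  ((x.zip d).filter (fun p => p.2 = false)).map Prod.fst

/-- Binary entropy function (base-2), with `binEnt 0 = binEnt 1 = 0`. -/
def binEnt (p : ℝ) : ℝ := -(p * Real.logb 2 p) - (1 - p) * Real.logb 2 (1 - p)

/-- The constant `C = ∑_{l≥1} 2^{-l-1} l log₂ l` (the `l = 0` term vanishes). -/
def Cconst : ℝ := ∑' l : ℕ, (2 : ℝ) ^ (-(l : ℝ) - 1) * (l : ℝ) * Real.logb 2 (l : ℝ)

/-- Probability of an event `E` under a pmf `p` on a finite outcome space. -/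
def prob {Ω : Type} [Fintype Ω] (p : Ω → ℝ) (E : Ω → Prop) : ℝ :=
  ∑ ω ∈ Finset.univ.filter E, p ω

/-- Conditional Shannon entropy (in bits) `H(f | g)` of the random variable `f`
given `g`, under the pmf `p`. -/
def condEnt {Ω A B : Type} [Fintype Ω] (p : Ω → ℝ) (f : Ω → A) (g : Ω → B) : ℝ :=
  -∑ ab ∈ Finset.univ.image (fun ω => (f ω, g ω)),
    (if prob p (fun ω => f ω = ab.1 ∧ g ω = ab.2) = 0 then 0
     else prob p (fun ω => f ω = ab.1 ∧ g ω = ab.2) *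
       Real.logb 2 (prob p (fun ω => f ω = ab.1 ∧ g ω = ab.2) /
         prob p (fun ω => g ω = ab.2)))

/-- Shannon entropy (in bits) `H(f)` of the random variable `f` under the pmf `p`. -/
def ent {Ω A : Type} [Fintype Ω] (p : Ω → ℝ) (f : Ω → A) : ℝ :=
  condEnt p f (fun _ => ())

/-- Stationary initial distribution of the deletion-pattern Markov chain:
`P(D₀ = 1) = β/(α+β)`. -/
def initD (α β : ℝ) (b : Bool) : ℝ := if b then β / (α + β) else α / (α + β)

/-- Transition probabilities of the deletion-pattern Markov chain:
`P(1|1) = 1-α`, `P(0|1) = α`, `P(1|0) = β`, `P(0|0) = 1-β`. -/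
def transD (α β : ℝ) (b b' : Bool) : ℝ :=
  if b then (if b' then 1 - α else α) else (if b' then β else 1 - β)

/-- Probability of a trajectory of the stationary two-state Markov chain. -/
def pMarkov (α β : ℝ) {m : ℕ} (dp : Fin (m + 1) → Bool) : ℝ :=
  initD α β (dp 0) * ∏ i : Fin m, transD α β (dp i.castSucc) (dp i.succ)

/-- Joint pmf of the iid Bernoulli(1/2) source `X^n = ω.1` and the independent
deletion pattern `(D_0, …, D_{n+1}) = ω.2`. -/
def pJoint (α β : ℝ) (n : ℕ) (ω : (Fin n → Bool) × (Fin (n + 2) → Bool)) : ℝ :=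
  (1 / 2 : ℝ) ^ n * pMarkov α β (m := n + 1) ω.2

/-- The deletion output `y(X^n, D^n)`: bits `X_i` with `D_i = 0` in order
(source bit `X_i` is governed by pattern bit `D_i`, i.e. index `i` of `ω.2`,
for `i = 1, …, n`). -/
def yOut {n : ℕ} (ω : (Fin n → Bool) × (Fin (n + 2) → Bool)) : List Bool :=
  yList (List.ofFn ω.1)
    (List.ofFn (fun i : Fin n => ω.2 ⟨i.val + 1, by have := i.isLt; omega⟩))

/-- `a_n = H(X^n | y(X^n, D^n), D_0, D_{n+1})`. -/
def aSeq (α β : ℝ) (n : ℕ) : ℝ :=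
  condEnt (pJoint α β n) (fun ω => ω.1)
    (fun ω => (yOut ω, ω.2 0, ω.2 (Fin.last (n + 1))))

/-- `E_n = H(D_1 | D_0, X^n, y(X^n, D^n), D_{n+1})`. -/
def Eseq (α β : ℝ) (n : ℕ) : ℝ :=
  condEnt (pJoint α β n) (fun ω => ω.2 1)
    (fun ω => (ω.2 0, ω.1, yOut ω, ω.2 (Fin.last (n + 1))))

/-- `H(y(X^n, D^n) | X^n, D_0, D_{n+1})`. -/
def hygSeq (α β : ℝ) (n : ℕ) : ℝ :=
  condEnt (pJoint α β n) (fun ω => yOut ω)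
    (fun ω => (ω.1, ω.2 0, ω.2 (Fin.last (n + 1))))

/-- `J_n = d + (1/n) H(y(X^n, D^n) | X^n, D_0, D_{n+1})` with `d = β/(α+β)`. -/
def Jseq (α β : ℝ) (n : ℕ) : ℝ := β / (α + β) + hygSeq α β n / n

/-- `I_n/n`: the normalized mutual information
`(1/n)(H(y(X^n,D^n)) - H(y(X^n,D^n)|X^n))`. -/
def Iseq (α β : ℝ) (n : ℕ) : ℝ :=
  (ent (pJoint α β n) (fun ω => yOut ω) -
    condEnt (pJoint α β n) (fun ω => yOut ω) (fun ω => ω.1)) / n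

/-- Error probability of a code `(enc, dec)` with message set `Fin M`. -/
def errProb (α β : ℝ) (n M : ℕ) (enc : (Fin n → Bool) → Fin M)
    (dec : Fin M × List Bool → (Fin n → Bool)) : ℝ :=
  prob (pJoint α β n) (fun ω => dec (enc ω.1, yOut ω) ≠ ω.1)

/-- `R` is an achievable rate: there is a sequence of codes whose error probability
tends to `0` and whose rate `(1/n) log₂ |M_n|` has limsup at most `R`. -/
def IsAchievable (α β R : ℝ) : Prop :=
  ∃ M : ℕ → ℕ, ∃ enc : (n : ℕ) → (Fin n → Bool) → Fin (M n),
    ∃ dec : (n : ℕ) → Fin (M n) × List Bool → (Fin n → Bool),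
      Tendsto (fun n => errProb α β n (M n) (enc n) (dec n)) atTop (nhds 0) ∧
      Filter.limsup (fun n : ℕ => Real.logb 2 (M n : ℝ) / (n : ℝ)) atTop ≤ R

/-- The minimum achievable rate `R_min(α, β)`. -/
def Rmin (α β : ℝ) : ℝ := sInf {R : ℝ | IsAchievable α β R}

/-- `k = max {6, -6 / log₂(1-α)}`. -/
def kconst (α : ℝ) : ℝ := max 6 (-6 / Real.logb 2 (1 - α))

/-- `m = ⌊-k log₂ β⌋`. -/
def mlen (α β : ℝ) : ℕ := ⌊kconst α * (-Real.logb 2 β)⌋₊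

/-- Number of ones among the entries of `dp` with index `≤ m`. -/
def onesCount {N : ℕ} (dp : Fin N → Bool) (m : ℕ) : ℕ :=
  (Finset.univ.filter (fun i : Fin N => i.val ≤ m ∧ dp i = true)).card

/-- Number of maximal runs of 1's among the entries of `dp` with index `≤ m`
(counted by their starting positions). -/
def runsCount {N : ℕ} (dp : Fin N → Bool) (m : ℕ) : ℕ :=
  (Finset.univ.filter (fun i : Fin N => i.val ≤ m ∧ dp i = true ∧
    (i.val = 0 ∨ dp ⟨i.val - 1, lt_of_le_of_lt (Nat.sub_le _ _) i.isLt⟩ = false))).card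

/-- The deletion pattern `(D_0, …, D_{n+1})` is typical: `(D_0, …, D_m)` contains at
most one maximal run of 1's and at most `⌊(k/3)(-log₂ β)⌋` ones, for `m = ⌊-k log₂ β⌋`. -/
def Typical (α β : ℝ) {n : ℕ} (dp : Fin (n + 2) → Bool) : Prop :=
  runsCount dp (mlen α β) ≤ 1 ∧
    onesCount dp (mlen α β) ≤ ⌊(kconst α / 3) * (-Real.logb 2 β)⌋₊

/-- The joint pmf conditioned on the event `{T = 1}` that the deletion pattern is typical. -/
def pTypCond (α β : ℝ) (n : ℕ) (ω : (Fin n → Bool) × (Fin (n + 2) → Bool)) : ℝ :=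
  if Typical α β ω.2 then
    pJoint α β n ω / prob (pJoint α β n) (fun ω' => Typical α β ω'.2)
  else 0

/-- `H(D_1 | X^n, y(X^n,D^n), D_0, D_{n+1}, T = 1) ⬝ P(T = 1)`. -/
def EseqTyp (α β : ℝ) (n : ℕ) : ℝ :=
  condEnt (pTypCond α β n) (fun ω => ω.2 1)
    (fun ω => (ω.2 0, ω.1, yOut ω, ω.2 (Fin.last (n + 1)))) *
  prob (pJoint α β n) (fun ω => Typical α β ω.2)

/-- `(1/k) H(X_2^{k-1} | y(X_2^{k-1}, D_2^{k-1}), D_1, D_k)` (unnormalized). -/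
def innerEnt (α β : ℝ) (k : ℕ) : ℝ :=
  condEnt (pJoint α β k)
    (fun ω => (fun i : Fin (k - 2) => ω.1 ⟨i.val + 1, by have := i.isLt; omega⟩))
    (fun ω =>
      (yList (List.ofFn (fun i : Fin (k - 2) => ω.1 ⟨i.val + 1, by have := i.isLt; omega⟩))
        (List.ofFn (fun i : Fin (k - 2) => ω.2 ⟨i.val + 2, by have := i.isLt; omega⟩)),
       ω.2 1, ω.2 ⟨k, by omega⟩))


/-! ### The entropy of splitting a mass into two parts -/

/-- The unnormalized binary entropy (in bits) of a mass `u + v` split into `u` and `v`. -/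
def splitEnt (u v : ℝ) : ℝ :=
  -(u * Real.logb 2 (u / (u + v))) - v * Real.logb 2 (v / (u + v))

lemma splitEnt_zero : splitEnt 0 0 = 0 := by simp [splitEnt]

lemma splitEnt_mul {c : ℝ} (hc : 0 ≤ c) (u v : ℝ) :
    splitEnt (c * u) (c * v) = c * splitEnt u v := by
  rcases hc.eq_or_lt with rfl | hc
  · simp [splitEnt]
  · unfold splitEnt
    rw [← mul_add, mul_div_mul_left _ _ hc.ne', mul_div_mul_left _ _ hc.ne']
    ring

lemma neg_mul_logb_div_nonneg {u s : ℝ} (hu : 0 ≤ u) (hs : u ≤ s) :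
    0 ≤ -(u * Real.logb 2 (u / s)) := by
  have : Real.logb 2 (u / s) ≤ 0 :=
    Real.logb_nonpos (by norm_num) (div_nonneg hu (hu.trans hs))
      (div_le_one_of_le₀ hs (hu.trans hs))
  nlinarith

lemma splitEnt_nonneg {u v : ℝ} (hu : 0 ≤ u) (hv : 0 ≤ v) : 0 ≤ splitEnt u v := by
  have h1 := neg_mul_logb_div_nonneg hu (le_add_of_nonneg_right hv)
  have h2 := neg_mul_logb_div_nonneg hv (le_add_of_nonneg_left hu)
  unfold splitEnt
  linarith

lemma neg_mul_logb_div_le {u s q : ℝ} (hu : 0 ≤ u) (hs : u ≤ s) (hq : 0 ≤ q)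
    (hqu : 0 < u → 0 < q) :
    -(u * Real.logb 2 (u / s)) ≤ -(u * Real.logb 2 q) + (q * s - u) / Real.log 2 := by
  have hl : 0 < Real.log 2 := Real.log_pos (by norm_num)
  rcases hu.eq_or_lt with rfl | hu
  · simp; positivity
  · have hsp : 0 < s := hu.trans_le hs
    have hqp := hqu hu
    have := Real.log_le_sub_one_of_pos (div_pos (mul_pos hqp hsp) hu)
    rw [Real.log_div (by positivity) hu.ne', Real.log_mul hqp.ne' hsp.ne'] at this
    have h2 := mul_le_mul_of_nonneg_left this hu.le
    have h3 : u * (q * s / u - 1) = q * s - u := by field_simp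
    unfold Real.logb
    rw [Real.log_div hu.ne' hsp.ne', mul_div_assoc', mul_div_assoc', ← neg_div, ← neg_div,
      ← add_div]
    gcongr
    linarith

lemma neg_mul_logb_div_le_sub {u s : ℝ} (hu : 0 ≤ u) (hs : u ≤ s) :
    -(u * Real.logb 2 (u / s)) ≤ (s - u) / Real.log 2 := by
  simpa using neg_mul_logb_div_le hu hs zero_le_one (fun _ => one_pos)

lemma splitEnt_le {u v : ℝ} (hu : 0 ≤ u) (hv : 0 ≤ v) :
    splitEnt u v ≤ (u + v) / Real.log 2 := by
  have h1 := neg_mul_logb_div_le_sub hu (le_add_of_nonneg_right hv)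
  have h2 := neg_mul_logb_div_le_sub hv (le_add_of_nonneg_left hu)
  have h3 : (u + v - u) / Real.log 2 + (u + v - v) / Real.log 2 = (u + v) / Real.log 2 := by
    ring
  unfold splitEnt
  linarith

/-- The log-sum inequality for two terms. -/
lemma neg_mul_logb_div_add_le {u u' s s' : ℝ} (hu : 0 ≤ u) (hu' : 0 ≤ u') (hs : u ≤ s)
    (hs' : u' ≤ s') :
    -(u * Real.logb 2 (u / s)) + -(u' * Real.logb 2 (u' / s')) ≤
      -((u + u') * Real.logb 2 ((u + u') / (s + s'))) := by
  have hq : 0 ≤ (u + u') / (s + s') := by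
    have := hu.trans hs
    have := hu'.trans hs'
    positivity
  rcases (add_nonneg hu hu').eq_or_lt with h0 | h0
  · have h1 : u = 0 := by linarith
    have h2 : u' = 0 := by linarith
    simp [h1, h2]
  · have hS : 0 < s + s' := by linarith
    have hqp : 0 < (u + u') / (s + s') := div_pos h0 hS
    have h1 := neg_mul_logb_div_le hu hs hq (fun _ => hqp)
    have h2 := neg_mul_logb_div_le hu' hs' hq (fun _ => hqp)
    have h3 : ((u + u') / (s + s') * s - u) / Real.log 2 +
        ((u + u') / (s + s') * s' - u') / Real.log 2 = 0 := by
      rw [← add_div]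
      field_simp
      ring
    linarith

lemma splitEnt_superadditive {u v u' v' : ℝ} (hu : 0 ≤ u) (hv : 0 ≤ v) (hu' : 0 ≤ u')
    (hv' : 0 ≤ v') :
    splitEnt u v + splitEnt u' v' ≤ splitEnt (u + u') (v + v') := by
  have h1 := neg_mul_logb_div_add_le hu hu' (le_add_of_nonneg_right hv)
    (le_add_of_nonneg_right hv')
  have h2 := neg_mul_logb_div_add_le hv hv' (le_add_of_nonneg_left hu)
    (le_add_of_nonneg_left hu')
  unfold splitEnt
  rw [show u + u' + (v + v') = u + v + (u' + v') by ring]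
  linarith

lemma sum_splitEnt_le {ι : Type*} (s : Finset ι) {u v : ι → ℝ} (hu : ∀ i, 0 ≤ u i)
    (hv : ∀ i, 0 ≤ v i) :
    ∑ i ∈ s, splitEnt (u i) (v i) ≤ splitEnt (∑ i ∈ s, u i) (∑ i ∈ s, v i) := by
  induction s using Finset.induction_on with
  | empty => simp [splitEnt_zero]
  | insert a s ha ih =>
    rw [Finset.sum_insert ha, Finset.sum_insert ha, Finset.sum_insert ha]
    have := splitEnt_superadditive (hu a) (hv a) (Finset.sum_nonneg fun i (_ : i ∈ s) => hu i)
      (Finset.sum_nonneg fun i (_ : i ∈ s) => hv i)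
    linarith

lemma splitEnt_eq_negMulLog {u v : ℝ} (hu : 0 ≤ u) (hv : 0 ≤ v) :
    splitEnt u v =
      (Real.negMulLog u + Real.negMulLog v - Real.negMulLog (u + v)) / Real.log 2 := by
  have key : ∀ {a s : ℝ}, 0 ≤ a → a ≤ s →
      a * Real.logb 2 (a / s) = (a * Real.log a - a * Real.log s) / Real.log 2 := by
    intro a s ha has
    rcases ha.eq_or_lt with rfl | ha
    · simp
    · unfold Real.logb
      rw [Real.log_div ha.ne' (ha.trans_le has).ne']
      ring
  unfold splitEnt Real.negMulLog
  rw [key hu (le_add_of_nonneg_right hv), key hv (le_add_of_nonneg_left hu)]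
  ring

/-- The chain rule for a two-by-two table of masses, in the form of an upper bound. -/
lemma splitEnt_add_le {u v u' v' : ℝ} (hu : 0 ≤ u) (hv : 0 ≤ v) (hu' : 0 ≤ u')
    (hv' : 0 ≤ v') :
    splitEnt (u + u') (v + v') ≤
      splitEnt u v + splitEnt u' v' + splitEnt (u + v) (u' + v') := by
  have h1 := splitEnt_nonneg hu hu'
  have h2 := splitEnt_nonneg hv hv'
  have h3 : splitEnt (u + u') (v + v') + splitEnt u u' + splitEnt v v' =
      splitEnt u v + splitEnt u' v' + splitEnt (u + v) (u' + v') := by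
    rw [splitEnt_eq_negMulLog hu hu', splitEnt_eq_negMulLog hv hv',
      splitEnt_eq_negMulLog hu hv, splitEnt_eq_negMulLog hu' hv',
      splitEnt_eq_negMulLog (add_nonneg hu hu') (add_nonneg hv hv'),
      splitEnt_eq_negMulLog (add_nonneg hu hv) (add_nonneg hu' hv'),
      show u + u' + (v + v') = u + v + (u' + v') by ring]
    ring
  linarith

/-! ### Conditional entropy of a bit -/

section CondEnt

variable {Ω B : Type} [Fintype Ω]

lemma prob_nonneg {p : Ω → ℝ} (hp : ∀ ω, 0 ≤ p ω) (E : Ω → Prop) : 0 ≤ prob p E :=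
  Finset.sum_nonneg fun ω _ => hp ω

lemma prob_eq_sum_ite (p : Ω → ℝ) (E : Ω → Prop) [DecidablePred E] :
    prob p E = ∑ ω, if E ω then p ω else 0 := by
  rw [prob, Finset.sum_filter]
  exact Finset.sum_congr rfl fun ω _ => by congr

lemma prob_add (p₁ p₂ : Ω → ℝ) (E : Ω → Prop) :
    prob (fun ω => p₁ ω + p₂ ω) E = prob p₁ E + prob p₂ E := by
  simp only [prob, Finset.sum_add_distrib]

lemma prob_mul (c : ℝ) (p : Ω → ℝ) (E : Ω → Prop) :
    prob (fun ω => c * p ω) E = c * prob p E := by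
  simp only [prob, Finset.mul_sum]

lemma prob_true_add_false (p : Ω → ℝ) (f : Ω → Bool) (E : Ω → Prop) :
    prob p (fun ω => f ω = true ∧ E ω) + prob p (fun ω => f ω = false ∧ E ω) = prob p E := by
  simp only [prob_eq_sum_ite, ← Finset.sum_add_distrib]
  refine Finset.sum_congr rfl fun ω _ => ?_
  cases f ω <;> simp

lemma sum_prob_eq (p : Ω → ℝ) (g : Ω → B) {S : Finset B} (hS : ∀ ω, g ω ∈ S) :
    ∑ b ∈ S, prob p (fun ω => g ω = b) = ∑ ω, p ω := by
  simp only [prob_eq_sum_ite]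
  rw [Finset.sum_comm]
  refine Finset.sum_congr rfl fun ω _ => ?_
  rw [Finset.sum_ite_eq, if_pos (hS ω)]

lemma prob_eq_zero {p : Ω → ℝ} {E : Ω → Prop} (h : ∀ ω, ¬ E ω) : prob p E = 0 := by
  simp [prob_eq_sum_ite, h]

lemma condEnt_eq_sum_splitEnt (p : Ω → ℝ) (f : Ω → Bool) (g : Ω → B) {S : Finset B}
    (hS : ∀ ω, g ω ∈ S) :
    condEnt p f g = ∑ b ∈ S, splitEnt (prob p (fun ω => f ω = true ∧ g ω = b))
      (prob p (fun ω => f ω = false ∧ g ω = b)) := by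
  unfold condEnt
  rw [Finset.sum_subset (s₂ := (Finset.univ : Finset Bool) ×ˢ S), Finset.sum_product_right,
    ← Finset.sum_neg_distrib]
  · refine Finset.sum_congr rfl fun b _ => ?_
    have hite : ∀ u t : ℝ, (if u = 0 then 0 else u * Real.logb 2 (u / t)) =
        u * Real.logb 2 (u / t) := by
      intro u t
      split_ifs with h <;> simp [h]
    simp only [hite, Fintype.sum_bool]
    rw [← prob_true_add_false p f (fun ω => g ω = b), splitEnt]
    ring
  · intro ab hab
    simp only [Finset.mem_image] at hab
    obtain ⟨ω, -, rfl⟩ := hab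
    simp [hS ω]
  · intro ab _ hab
    rw [if_pos]
    simp only [Finset.mem_image, not_exists] at hab
    exact prob_eq_zero fun ω hω => hab ω ⟨Finset.mem_univ _, Prod.ext hω.1 hω.2⟩

lemma condEnt_nonneg {p : Ω → ℝ} (hp : ∀ ω, 0 ≤ p ω) (f : Ω → Bool) (g : Ω → B) :
    0 ≤ condEnt p f g := by
  rw [condEnt_eq_sum_splitEnt p f g (S := Finset.univ.image g) (by simp)]
  exact Finset.sum_nonneg fun b _ => splitEnt_nonneg (prob_nonneg hp _) (prob_nonneg hp _)

lemma condEnt_le {p : Ω → ℝ} (hp : ∀ ω, 0 ≤ p ω) (f : Ω → Bool) (g : Ω → B) :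
    condEnt p f g ≤ (∑ ω, p ω) / Real.log 2 := by
  have hS : ∀ ω, g ω ∈ Finset.univ.image g := by simp
  rw [condEnt_eq_sum_splitEnt p f g hS, ← sum_prob_eq p g hS, Finset.sum_div]
  refine Finset.sum_le_sum fun b _ => ?_
  rw [← prob_true_add_false p f (fun ω => g ω = b)]
  exact splitEnt_le (prob_nonneg hp _) (prob_nonneg hp _)

lemma condEnt_mul {c : ℝ} (hc : 0 ≤ c) (p : Ω → ℝ) (f : Ω → Bool) (g : Ω → B) :
    condEnt (fun ω => c * p ω) f g = c * condEnt p f g := by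
  have hS : ∀ ω, g ω ∈ Finset.univ.image g := by simp
  rw [condEnt_eq_sum_splitEnt _ f g hS, condEnt_eq_sum_splitEnt _ f g hS, Finset.mul_sum]
  refine Finset.sum_congr rfl fun b _ => ?_
  rw [prob_mul, prob_mul, splitEnt_mul hc]

lemma condEnt_le_condEnt_add {p₁ p₂ : Ω → ℝ} (h₁ : ∀ ω, 0 ≤ p₁ ω) (h₂ : ∀ ω, 0 ≤ p₂ ω)
    (f : Ω → Bool) (g : Ω → B) :
    condEnt p₁ f g ≤ condEnt (fun ω => p₁ ω + p₂ ω) f g := by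
  have hS : ∀ ω, g ω ∈ Finset.univ.image g := by simp
  rw [condEnt_eq_sum_splitEnt _ f g hS, condEnt_eq_sum_splitEnt _ f g hS]
  refine Finset.sum_le_sum fun b _ => ?_
  rw [prob_add, prob_add]
  refine le_trans ?_ (splitEnt_superadditive (prob_nonneg h₁ _) (prob_nonneg h₁ _)
    (prob_nonneg h₂ _) (prob_nonneg h₂ _))
  exact le_add_of_nonneg_right (splitEnt_nonneg (prob_nonneg h₂ _) (prob_nonneg h₂ _))

lemma condEnt_add_le {p₁ p₂ : Ω → ℝ} (h₁ : ∀ ω, 0 ≤ p₁ ω) (h₂ : ∀ ω, 0 ≤ p₂ ω)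
    (f : Ω → Bool) (g : Ω → B) :
    condEnt (fun ω => p₁ ω + p₂ ω) f g ≤
      condEnt p₁ f g + condEnt p₂ f g + splitEnt (∑ ω, p₁ ω) (∑ ω, p₂ ω) := by
  have hS : ∀ ω, g ω ∈ Finset.univ.image g := by simp
  have h := sum_splitEnt_le (Finset.univ.image g)
    (fun b => prob_nonneg h₁ (fun ω => g ω = b)) (fun b => prob_nonneg h₂ (fun ω => g ω = b))
  rw [sum_prob_eq p₁ g hS, sum_prob_eq p₂ g hS] at h
  refine le_trans ?_ (add_le_add_right h _)
  rw [condEnt_eq_sum_splitEnt _ f g hS, condEnt_eq_sum_splitEnt _ f g hS,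
    condEnt_eq_sum_splitEnt _ f g hS, ← Finset.sum_add_distrib, ← Finset.sum_add_distrib]
  refine Finset.sum_le_sum fun b _ => ?_
  rw [prob_add, prob_add, ← prob_true_add_false p₁ f (fun ω => g ω = b),
    ← prob_true_add_false p₂ f (fun ω => g ω = b)]
  exact splitEnt_add_le (prob_nonneg h₁ _) (prob_nonneg h₁ _)
    (prob_nonneg h₂ _) (prob_nonneg h₂ _)

/-- If the outcome space is enlarged by a variable that depends on the old outcome only through
the conditioning `g`, and the new conditioning is a function of `g` and that variable, then the
conditional entropy of a bit does not decrease. -/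
lemma condEnt_le_of_extension {Ω' B' C : Type} [Fintype Ω'] [Fintype C] {p : Ω → ℝ}
    {p' : Ω' → ℝ} (hp : ∀ ω, 0 ≤ p ω) {f : Ω → Bool} {f' : Ω' → Bool} {g : Ω → B}
    {g' : Ω' → B'} (e : Ω × C ≃ Ω') (κ : B → C → ℝ) (hκ : ∀ b c, 0 ≤ κ b c)
    (hκ1 : ∀ b, ∑ c, κ b c = 1) (φ : B → C → B')
    (hpe : ∀ ω c, p' (e (ω, c)) = p ω * κ (g ω) c) (hfe : ∀ ω c, f' (e (ω, c)) = f ω)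
    (hge : ∀ ω c, g' (e (ω, c)) = φ (g ω) c) :
    condEnt p f g ≤ condEnt p' f' g' := by
  have hS : ∀ ω, g ω ∈ Finset.univ.image g := by simp
  have hS' : ∀ ω, g' ω ∈ Finset.univ.image g' := by simp
  set S := Finset.univ.image g with hSdef
  set S' := Finset.univ.image g' with hSdef'
  have hmass : ∀ a b', prob p' (fun ω => f' ω = a ∧ g' ω = b') =
      ∑ bc ∈ (S ×ˢ (Finset.univ : Finset C)).filter (fun bc => φ bc.1 bc.2 = b'),
        κ bc.1 bc.2 * prob p (fun ω => f ω = a ∧ g ω = bc.1) := by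
    intro a b'
    rw [prob_eq_sum_ite, ← e.sum_comp, Fintype.sum_prod_type, Finset.sum_filter,
      Finset.sum_product_right, Finset.sum_comm]
    refine Finset.sum_congr rfl fun c _ => ?_
    simp only [hpe, hfe, hge, prob_eq_sum_ite]
    have : ∀ b ∈ S, (if φ b c = b' then
        κ b c * ∑ ω, (if f ω = a ∧ g ω = b then p ω else 0) else 0) =
        ∑ ω, if g ω = b then (if f ω = a ∧ φ (g ω) c = b' then p ω * κ (g ω) c else 0)
          else 0 := by
      intro b _
      split_ifs with hb
      · rw [Finset.mul_sum]
        refine Finset.sum_congr rfl fun ω _ => ?_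
        by_cases hg : g ω = b
        · subst hg
          by_cases hf : f ω = a <;> simp [hf, hb, mul_comm]
        · simp [hg]
      · refine (Finset.sum_eq_zero fun ω _ => ?_).symm
        by_cases hg : g ω = b
        · subst hg
          simp [hb]
        · simp [hg]
    rw [Finset.sum_congr rfl this, Finset.sum_comm]
    refine Finset.sum_congr rfl fun ω _ => ?_
    rw [Finset.sum_ite_eq, if_pos (hS ω)]
  have hmaps : ∀ bc ∈ S ×ˢ (Finset.univ : Finset C), φ bc.1 bc.2 ∈ S' := by
    rintro ⟨b, c⟩ hbc
    obtain ⟨ω, -, rfl⟩ := Finset.mem_image.1 (Finset.mem_product.1 hbc).1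
    simp only [← hge]
    exact hS' _
  rw [condEnt_eq_sum_splitEnt p f g hS, condEnt_eq_sum_splitEnt p' f' g' hS']
  calc ∑ b ∈ S, splitEnt (prob p (fun ω => f ω = true ∧ g ω = b))
          (prob p (fun ω => f ω = false ∧ g ω = b))
      = ∑ bc ∈ S ×ˢ (Finset.univ : Finset C),
          splitEnt (κ bc.1 bc.2 * prob p (fun ω => f ω = true ∧ g ω = bc.1))
            (κ bc.1 bc.2 * prob p (fun ω => f ω = false ∧ g ω = bc.1)) := by
        rw [Finset.sum_product]
        refine Finset.sum_congr rfl fun b _ => ?_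
        simp only [splitEnt_mul (hκ _ _)]
        rw [← Finset.sum_mul, hκ1, one_mul]
    _ = ∑ b' ∈ S', ∑ bc ∈ (S ×ˢ (Finset.univ : Finset C)).filter
          (fun bc => φ bc.1 bc.2 = b'),
          splitEnt (κ bc.1 bc.2 * prob p (fun ω => f ω = true ∧ g ω = bc.1))
            (κ bc.1 bc.2 * prob p (fun ω => f ω = false ∧ g ω = bc.1)) :=
        (Finset.sum_fiberwise_of_maps_to hmaps _).symm
    _ ≤ _ := by
        refine Finset.sum_le_sum fun b' _ => ?_
        rw [hmass, hmass]
        exact sum_splitEnt_le _ (fun bc => mul_nonneg (hκ _ _) (prob_nonneg hp _))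
          (fun bc => mul_nonneg (hκ _ _) (prob_nonneg hp _))

end CondEnt

/-! ### Extending the deletion pattern by one step -/

lemma initD_nonneg {α β : ℝ} (hα : 0 ≤ α) (hβ : 0 ≤ β) (b : Bool) : 0 ≤ initD α β b := by
  unfold initD
  split_ifs <;> positivity

lemma transD_nonneg {α β : ℝ} (hα : 0 ≤ α) (hα1 : α ≤ 1) (hβ : 0 ≤ β) (hβ1 : β ≤ 1)
    (b b' : Bool) : 0 ≤ transD α β b b' := by
  unfold transD
  split_ifs <;> linarith

lemma sum_transD (α β : ℝ) (b : Bool) : ∑ b', transD α β b b' = 1 := by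
  cases b <;> simp [transD]

lemma pMarkov_nonneg {α β : ℝ} (hα : 0 ≤ α) (hα1 : α ≤ 1) (hβ : 0 ≤ β) (hβ1 : β ≤ 1)
    {m : ℕ} (dp : Fin (m + 1) → Bool) : 0 ≤ pMarkov α β dp :=
  mul_nonneg (initD_nonneg hα hβ _)
    (Finset.prod_nonneg fun _ _ => transD_nonneg hα hα1 hβ hβ1 _ _)

lemma pJoint_nonneg {α β : ℝ} (hα : 0 ≤ α) (hα1 : α ≤ 1) (hβ : 0 ≤ β) (hβ1 : β ≤ 1)
    {n : ℕ} (ω : (Fin n → Bool) × (Fin (n + 2) → Bool)) : 0 ≤ pJoint α β n ω :=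
  mul_nonneg (by positivity) (pMarkov_nonneg hα hα1 hβ hβ1 _)

/-- Appending one more source bit and one more pattern bit. -/
def extendEquiv (n : ℕ) :
    ((Fin n → Bool) × (Fin (n + 2) → Bool)) × (Bool × Bool) ≃
      (Fin (n + 1) → Bool) × (Fin (n + 1 + 2) → Bool) where
  toFun z := (Fin.snoc (α := fun _ => Bool) z.1.1 z.2.1,
    Fin.snoc (α := fun _ => Bool) z.1.2 z.2.2)
  invFun w := ((Fin.init (α := fun _ => Bool) w.1, Fin.init (α := fun _ => Bool) w.2),
    (w.1 (Fin.last n), w.2 (Fin.last (n + 2))))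
  left_inv z := by simp
  right_inv w := by simp

lemma snoc_mk {N : ℕ} (d : Fin N → Bool) (b : Bool) (k : ℕ) (h : k < N) (h' : k < N + 1) :
    Fin.snoc (α := fun _ => Bool) d b ⟨k, h'⟩ = d ⟨k, h⟩ :=
  Fin.snoc_castSucc (α := fun _ => Bool) b d ⟨k, h⟩

lemma pMarkov_snoc (α β : ℝ) {m : ℕ} (d : Fin (m + 1) → Bool) (b : Bool) :
    pMarkov α β (m := m + 1) (Fin.snoc (α := fun _ => Bool) d b) =
      pMarkov α β d * transD α β (d (Fin.last m)) b := by
  unfold pMarkov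
  rw [Fin.prod_univ_castSucc, ← mul_assoc]
  congr 1
  · congr 1
    refine Finset.prod_congr rfl fun i _ => ?_
    rw [Fin.succ_castSucc, Fin.snoc_castSucc, Fin.snoc_castSucc]
  · rw [Fin.snoc_castSucc, Fin.succ_last, Fin.snoc_last]

lemma pJoint_extendEquiv (α β : ℝ) (n : ℕ) (ω : (Fin n → Bool) × (Fin (n + 2) → Bool))
    (c : Bool × Bool) :
    pJoint α β (n + 1) (extendEquiv n (ω, c)) =
      pJoint α β n ω * (1 / 2 * transD α β (ω.2 (Fin.last (n + 1))) c.2) := by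
  have h := pMarkov_snoc α β ω.2 c.2
  unfold pJoint
  change _ * pMarkov α β (m := n + 1 + 1) (Fin.snoc (α := fun _ => Bool) ω.2 c.2) = _
  rw [h]
  ring

lemma yList_append_singleton {x d : List Bool} (h : x.length = d.length) (a b : Bool) :
    yList (x ++ [a]) (d ++ [b]) = yList x d ++ if b then [] else [a] := by
  unfold yList
  rw [List.zip_append h]
  cases b <;> simp

lemma ofFn_snoc {N : ℕ} (d : Fin N → Bool) (b : Bool) :
    List.ofFn (Fin.snoc (α := fun _ => Bool) d b : Fin (N + 1) → Bool) =
      List.ofFn d ++ [b] := by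
  rw [List.ofFn_succ']
  simp

lemma yOut_extendEquiv (n : ℕ) (ω : (Fin n → Bool) × (Fin (n + 2) → Bool))
    (c : Bool × Bool) :
    yOut (extendEquiv n (ω, c)) =
      yOut ω ++ if ω.2 (Fin.last (n + 1)) then [] else [c.1] := by
  unfold yOut
  rw [← yList_append_singleton (by simp), ← ofFn_snoc, ← ofFn_snoc]
  congr 2
  funext i
  refine Fin.lastCases ?_ (fun j => ?_) i
  · rw [Fin.snoc_last]
    exact snoc_mk ω.2 c.2 (n + 1) (by omega) (by omega)
  · rw [Fin.snoc_castSucc]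
    exact snoc_mk ω.2 c.2 (j + 1) (by omega) (by omega)

/-- The conditioning variables `(D_0, X^n, y(X^n, D^n), D_{n+1})`. -/
def observed {n : ℕ} (ω : (Fin n → Bool) × (Fin (n + 2) → Bool)) :
    Bool × (Fin n → Bool) × List Bool × Bool :=
  (ω.2 0, ω.1, yOut ω, ω.2 (Fin.last (n + 1)))

lemma condEnt_le_condEnt_extend {α β : ℝ} (hα : 0 ≤ α) (hα1 : α ≤ 1) (hβ : 0 ≤ β)
    (hβ1 : β ≤ 1) {n : ℕ} {p : (Fin n → Bool) × (Fin (n + 2) → Bool) → ℝ}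
    {p' : (Fin (n + 1) → Bool) × (Fin (n + 1 + 2) → Bool) → ℝ} (hp : ∀ ω, 0 ≤ p ω)
    (hpe : ∀ ω c, p' (extendEquiv n (ω, c)) =
      p ω * (1 / 2 * transD α β (ω.2 (Fin.last (n + 1))) c.2)) :
    condEnt p (fun ω => ω.2 1) observed ≤ condEnt p' (fun ω => ω.2 1) observed := by
  refine condEnt_le_of_extension hp (extendEquiv n)
    (fun b c => 1 / 2 * transD α β b.2.2.2 c.2)
    (fun b c => mul_nonneg (by norm_num) (transD_nonneg hα hα1 hβ hβ1 _ _))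
    (fun b => ?_)
    (fun b c => (b.1, Fin.snoc (α := fun _ => Bool) b.2.1 c.1,
      b.2.2.1 ++ (if b.2.2.2 then [] else [c.1]), c.2)) hpe (fun ω c => ?_) (fun ω c => ?_)
  · rw [Fintype.sum_prod_type]
    simp only [← Finset.mul_sum, sum_transD]
    simp
  · exact snoc_mk ω.2 c.2 1 (by omega) (by omega)
  · refine Prod.ext ?_ (Prod.ext rfl (Prod.ext ?_ ?_))
    · exact snoc_mk ω.2 c.2 0 (by omega) (by omega)
    · exact yOut_extendEquiv n ω c
    · exact Fin.snoc_last (α := fun _ => Bool) c.2 ω.2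

lemma onesCount_snoc {N m : ℕ} (hm : m < N) (d : Fin N → Bool) (b : Bool) :
    onesCount (Fin.snoc (α := fun _ => Bool) d b : Fin (N + 1) → Bool) m = onesCount d m := by
  unfold onesCount
  rw [Finset.card_filter, Finset.card_filter, Fin.sum_univ_castSucc]
  simp [hm]

lemma runsCount_snoc {N m : ℕ} (hm : m < N) (d : Fin N → Bool) (b : Bool) :
    runsCount (Fin.snoc (α := fun _ => Bool) d b : Fin (N + 1) → Bool) m = runsCount d m := by
  unfold runsCount
  rw [Finset.card_filter, Finset.card_filter, Fin.sum_univ_castSucc]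
  have h : ∀ i : Fin N, Fin.snoc (α := fun _ => Bool) d b
      (⟨i.val - 1, by omega⟩ : Fin (N + 1)) = d ⟨i.val - 1, by omega⟩ :=
    fun i => snoc_mk d b _ _ _
  simp [hm, h]

lemma typical_extendEquiv {α β : ℝ} {n : ℕ} (hm : mlen α β < n)
    (ω : (Fin n → Bool) × (Fin (n + 2) → Bool)) (c : Bool × Bool) :
    Typical α β (extendEquiv n (ω, c)).2 ↔ Typical α β ω.2 := by
  have hm' : mlen α β < n + 2 := by omega
  unfold Typical
  rw [← onesCount_snoc hm' ω.2 c.2, ← runsCount_snoc hm' ω.2 c.2]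
  rfl

/-- The joint weights restricted to typical deletion patterns. -/
def pTyp (α β : ℝ) (n : ℕ) (ω : (Fin n → Bool) × (Fin (n + 2) → Bool)) : ℝ :=
  if Typical α β ω.2 then pJoint α β n ω else 0

/-- The joint weights restricted to atypical deletion patterns. -/
def pAtyp (α β : ℝ) (n : ℕ) (ω : (Fin n → Bool) × (Fin (n + 2) → Bool)) : ℝ :=
  if Typical α β ω.2 then 0 else pJoint α β n ω

lemma Eseq_eq (α β : ℝ) (n : ℕ) :
    Eseq α β n =
      condEnt (fun ω => pTyp α β n ω + pAtyp α β n ω) (fun ω => ω.2 1) observed := by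
  have : (fun ω => pTyp α β n ω + pAtyp α β n ω) = pJoint α β n := by
    funext ω
    unfold pTyp pAtyp
    split_ifs <;> simp
  rw [this]
  rfl

lemma pTyp_nonneg {α β : ℝ} (hα : 0 ≤ α) (hα1 : α ≤ 1) (hβ : 0 ≤ β)
    (hβ1 : β ≤ 1)
    {n : ℕ} (ω : (Fin n → Bool) × (Fin (n + 2) → Bool)) :
    0 ≤ pTyp α β n ω := by
  unfold pTyp
  split_ifs
  exacts [pJoint_nonneg hα hα1 hβ hβ1 ω, le_rfl]

lemma pAtyp_nonneg {α β : ℝ} (hα : 0 ≤ α) (hα1 : α ≤ 1) (hβ : 0 ≤ β)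
    (hβ1 : β ≤ 1)
    {n : ℕ} (ω : (Fin n → Bool) × (Fin (n + 2) → Bool)) :
    0 ≤ pAtyp α β n ω := by
  unfold pAtyp
  split_ifs
  exacts [le_rfl, pJoint_nonneg hα hα1 hβ hβ1 ω]

lemma EseqTyp_eq {α β : ℝ} (hα : 0 ≤ α) (hα1 : α ≤ 1) (hβ : 0 ≤ β)
    (hβ1 : β ≤ 1)
    (n : ℕ) :
    EseqTyp α β n = condEnt (pTyp α β n) (fun ω => ω.2 1) observed := by
  have hsum : prob (pJoint α β n) (fun ω => Typical α β ω.2) = ∑ ω, pTyp α β n ω := by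
    rw [prob_eq_sum_ite]
    rfl
  have hc : 0 ≤ ∑ ω, pTyp α β n ω :=
    Finset.sum_nonneg fun ω _ => pTyp_nonneg hα hα1 hβ hβ1 ω
  have hcond : pTypCond α β n = fun ω => (∑ ω, pTyp α β n ω)⁻¹ * pTyp α β n ω := by
    funext ω
    unfold pTypCond
    rw [hsum]
    conv_rhs => rw [pTyp]
    split_ifs
    · rw [div_eq_inv_mul]
    · simp
  have h : EseqTyp α β n =
      (∑ ω, pTyp α β n ω)⁻¹ * condEnt (pTyp α β n) (fun ω => ω.2 1) observed *
        ∑ ω, pTyp α β n ω := by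
    rw [← condEnt_mul (inv_nonneg.2 hc), ← hcond, ← hsum]
    rfl
  rw [h]
  rcases hc.eq_or_lt with h0 | h0
  · have h1 := condEnt_nonneg (pTyp_nonneg hα hα1 hβ hβ1) (fun ω => ω.2 1) (observed (n := n))
    have h2 := condEnt_le (pTyp_nonneg hα hα1 hβ hβ1) (fun ω => ω.2 1) (observed (n := n))
    rw [← h0, zero_div] at h2
    rw [← h0]
    simp [le_antisymm h2 h1]
  · field_simp

lemma Eseq_le_succ {α β : ℝ} (hα : 0 ≤ α) (hα1 : α ≤ 1) (hβ : 0 ≤ β)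
    (hβ1 : β ≤ 1)
    (n : ℕ) : Eseq α β n ≤ Eseq α β (n + 1) :=
  condEnt_le_condEnt_extend hα hα1 hβ hβ1 (pJoint_nonneg hα hα1 hβ hβ1)
    (pJoint_extendEquiv α β n)

lemma EseqTyp_le_succ {α β : ℝ} (hα : 0 ≤ α) (hα1 : α ≤ 1) (hβ : 0 ≤ β)
    (hβ1 : β ≤ 1)
    {n : ℕ} (hn : mlen α β < n) : EseqTyp α β n ≤ EseqTyp α β (n + 1) := by
  rw [EseqTyp_eq hα hα1 hβ hβ1, EseqTyp_eq hα hα1 hβ hβ1]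
  refine condEnt_le_condEnt_extend hα hα1 hβ hβ1 (pTyp_nonneg hα hα1 hβ hβ1) fun ω c => ?_
  unfold pTyp
  rw [pJoint_extendEquiv]
  simp only [typical_extendEquiv hn]
  split_ifs <;> simp

lemma EseqTyp_le_Eseq {α β : ℝ} (hα : 0 ≤ α) (hα1 : α ≤ 1) (hβ : 0 ≤ β)
    (hβ1 : β ≤ 1)
    (n : ℕ) : EseqTyp α β n ≤ Eseq α β n := by
  rw [EseqTyp_eq hα hα1 hβ hβ1, Eseq_eq]
  exact condEnt_le_condEnt_add (pTyp_nonneg hα hα1 hβ hβ1) (pAtyp_nonneg hα hα1 hβ hβ1) _ _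

lemma Eseq_sub_EseqTyp_le {α β : ℝ} (hα : 0 ≤ α) (hα1 : α ≤ 1) (hβ : 0 ≤ β)
    (hβ1 : β ≤ 1)
    (n : ℕ) :
    Eseq α β n - EseqTyp α β n ≤
      (∑ ω, pAtyp α β n ω) / Real.log 2 +
        splitEnt (∑ ω, pTyp α β n ω) (∑ ω, pAtyp α β n ω) := by
  rw [EseqTyp_eq hα hα1 hβ hβ1, Eseq_eq]
  have h1 := condEnt_add_le (pTyp_nonneg hα hα1 hβ hβ1) (pAtyp_nonneg hα hα1 hβ hβ1)
    (fun ω => ω.2 1) (observed (n := n))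
  have h2 := condEnt_le (pAtyp_nonneg hα hα1 hβ hβ1) (fun ω => ω.2 1) (observed (n := n))
  linarith

/-! ### The probability of an atypical deletion pattern -/

lemma sum_path_le {N : ℕ} {q : Bool → ℝ} (hq : ∀ b, 0 ≤ q b) {w : Fin N → Bool → Bool → ℝ}
    (hw : ∀ t b b', 0 ≤ w t b b') {c : Fin N → ℝ} (hc : ∀ t b, ∑ b', w t b b' ≤ c t) :
    ∑ d : Fin (N + 1) → Bool, q (d 0) * ∏ t, w t (d t.castSucc) (d t.succ) ≤
      (∑ b, q b) * ∏ t, c t := by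
  induction N with
  | zero =>
    rw [← (Equiv.funUnique (Fin 1) Bool).symm.sum_comp]
    simp
  | succ N ih =>
    have ih' := ih (w := fun t => w t.castSucc) (c := fun t => c t.castSucc)
      (fun t => hw t.castSucc) (fun t => hc t.castSucc)
    rw [← (Fin.snocEquiv (fun _ => Bool)).sum_comp, Fintype.sum_prod_type_right,
      Fin.prod_univ_castSucc, ← mul_assoc]
    have hcN : 0 ≤ c (Fin.last N) :=
      (Finset.sum_nonneg fun b' _ => hw (Fin.last N) true b').trans (hc (Fin.last N) true)
    refine le_trans ?_ (mul_le_mul_of_nonneg_right ih' hcN)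
    rw [Finset.sum_mul]
    refine Finset.sum_le_sum fun d _ => ?_
    have hstep : ∀ b : Bool,
        q (Fin.snocEquiv (fun _ => Bool) (b, d) 0) *
          ∏ t, w t (Fin.snocEquiv (fun _ => Bool) (b, d) t.castSucc)
            (Fin.snocEquiv (fun _ => Bool) (b, d) t.succ) =
        (q (d 0) * ∏ t : Fin N, w t.castSucc (d t.castSucc) (d t.succ)) *
          w (Fin.last N) (d (Fin.last N)) b := by
      intro b
      rw [Fin.prod_univ_castSucc, ← mul_assoc]
      congr 1
      · congr 1
        refine Finset.prod_congr rfl fun t _ => ?_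
        rw [Fin.succ_castSucc]
        simp only [Fin.snocEquiv, Equiv.coe_fn_mk, Fin.snoc_castSucc]
      · simp only [Fin.snocEquiv, Equiv.coe_fn_mk, Fin.snoc_castSucc, Fin.succ_last,
          Fin.snoc_last]
    simp only [hstep]
    rw [← Finset.mul_sum]
    exact mul_le_mul_of_nonneg_left (hc _ _)
      (mul_nonneg (hq _) (Finset.prod_nonneg fun t _ => hw _ _ _))

lemma prob_le_sum_prob {Ω ι : Type} [Fintype Ω] {p : Ω → ℝ} (hp : ∀ ω, 0 ≤ p ω)
    (s : Finset ι) (E : Ω → Prop) (F : ι → Ω → Prop) (h : ∀ ω, E ω → ∃ i ∈ s, F i ω) :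
    prob p E ≤ ∑ i ∈ s, prob p (F i) := by
  simp only [prob_eq_sum_ite]
  rw [Finset.sum_comm]
  refine Finset.sum_le_sum fun ω _ => ?_
  have hnn : ∀ i ∈ s, 0 ≤ if F i ω then p ω else 0 := by
    intro i _
    split_ifs
    exacts [hp ω, le_rfl]
  split_ifs with hE
  · obtain ⟨i, his, hi⟩ := h ω hE
    refine le_trans ?_ (Finset.single_le_sum hnn his)
    rw [if_pos hi]
  · exact Finset.sum_nonneg hnn

lemma prob_le_add_prob {Ω : Type} [Fintype Ω] {p : Ω → ℝ} (hp : ∀ ω, 0 ≤ p ω)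
    (E F G : Ω → Prop) (h : ∀ ω, E ω → F ω ∨ G ω) : prob p E ≤ prob p F + prob p G := by
  simp only [prob_eq_sum_ite, ← Finset.sum_add_distrib]
  refine Finset.sum_le_sum fun ω _ => ?_
  have := h ω
  have := hp ω
  split_ifs <;> first | linarith | tauto

lemma prob_mono {Ω : Type} [Fintype Ω] {p : Ω → ℝ} (hp : ∀ ω, 0 ≤ p ω) {E F : Ω → Prop}
    (h : ∀ ω, E ω → F ω) : prob p E ≤ prob p F :=
  Finset.sum_le_sum_of_subset_of_nonneg (Finset.monotone_filter_right _ fun ω _ => h ω)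
    fun ω _ _ => hp ω

/-- A maximal run of ones of `d` starts at `i`. -/
def RunStart {N : ℕ} (d : Fin N → Bool) (i : Fin N) : Prop :=
  d i = true ∧
    (i.val = 0 ∨ d ⟨i.val - 1, lt_of_le_of_lt (Nat.sub_le _ _) i.isLt⟩ = false)

/-- An atypical pattern has two run starts or one long run of ones. -/
lemma exists_of_not_typical {N m L : ℕ} (d : Fin N → Bool)
    (h : ¬ (runsCount d m ≤ 1 ∧ onesCount d m ≤ L)) :
    (∃ i j : Fin N, i.val ≤ m ∧ j.val ≤ m ∧ i < j ∧ RunStart d i ∧ RunStart d j) ∨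
      ∃ i : Fin N, i.val ≤ m ∧ i.val + L ≤ m ∧ RunStart d i ∧
        ∀ t : Fin N, i ≤ t → t.val ≤ i.val + L → d t = true := by
  by_cases h1 : runsCount d m ≤ 1
  · right
    have h2 : L < onesCount d m := by
      by_contra h2
      exact h ⟨h1, not_lt.1 h2⟩
    unfold onesCount at h2
    unfold runsCount at h1
    set O := Finset.univ.filter (fun i : Fin N => i.val ≤ m ∧ d i = true) with hO
    have hmem : ∀ a, a ∈ O ↔ a.val ≤ m ∧ d a = true := by simp [hO]
    have hne : O.Nonempty := Finset.card_pos.1 (by omega)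
    obtain ⟨i, hiO, hmin⟩ := O.exists_min_image id hne
    simp only [id] at hmin
    have hi := (hmem i).1 hiO
    have hstart : RunStart d i := by
      refine ⟨hi.2, ?_⟩
      by_contra hcon
      rw [not_or, Bool.not_eq_false] at hcon
      have := hmin _ ((hmem _).2 ⟨by simp; omega, hcon.2⟩)
      rw [Fin.le_def] at this
      simp at this
      omega
    have hdown : ∀ a ∈ O, i < a →
        (⟨a.val - 1, lt_of_le_of_lt (Nat.sub_le _ _) a.isLt⟩ : Fin N) ∈ O := by
      intro a ha hia
      by_contra hcon
      have ha' := (hmem a).1 ha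
      have hfalse : d ⟨a.val - 1, lt_of_le_of_lt (Nat.sub_le _ _) a.isLt⟩ = false := by
        by_contra hd
        rw [Bool.not_eq_false] at hd
        exact hcon ((hmem _).2 ⟨by simp; omega, hd⟩)
      refine absurd (Finset.card_le_one.1 h1 i ?_ a ?_) hia.ne
      · exact Finset.mem_filter.2 ⟨Finset.mem_univ _, hi.1, hstart⟩
      · exact Finset.mem_filter.2 ⟨Finset.mem_univ _, ha'.1, ha'.2, Or.inr hfalse⟩
    have hclosed : ∀ k : ℕ, ∀ a ∈ O, ∀ t : Fin N, i ≤ t → t.val + k = a.val → t ∈ O := by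
      intro k
      induction k with
      | zero =>
        intro a ha t _ hta
        rwa [show t = a from Fin.ext hta]
      | succ k ih =>
        intro a ha t hit hta
        have hia : i < a := by
          rw [Fin.le_def] at hit
          rw [Fin.lt_def]
          omega
        exact ih _ (hdown a ha hia) t hit (by simp; omega)
    have hlong : ∀ k ≤ L, ∃ a ∈ O, i.val + k ≤ a.val := by
      intro k hk
      by_contra! hcon
      have hsub : O.image Fin.val ⊆ Finset.Ico i.val (i.val + k) := by
        intro v hv
        obtain ⟨a, ha, rfl⟩ := Finset.mem_image.1 hv
        exact Finset.mem_Ico.2 ⟨hmin a ha, hcon a ha⟩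
      have := Finset.card_le_card hsub
      rw [Finset.card_image_of_injective _ Fin.val_injective, Nat.card_Ico] at this
      omega
    refine ⟨i, hi.1, ?_, hstart, fun t hit htL => ?_⟩
    · obtain ⟨a, ha, hia⟩ := hlong L le_rfl
      exact hia.trans ((hmem a).1 ha).1
    · obtain ⟨a, ha, hia⟩ := hlong (t.val - i.val) (by omega)
      rw [Fin.le_def] at hit
      exact ((hmem t).1 (hclosed (a.val - t.val) a ha t hit (by omega))).2
  · left
    unfold runsCount at h1
    rw [not_le, Finset.one_lt_card] at h1
    obtain ⟨a, ha, b, hb, hab⟩ := h1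
    have ha := (Finset.mem_filter.1 ha).2
    have hb := (Finset.mem_filter.1 hb).2
    rcases lt_or_gt_of_ne hab with hab | hab
    · exact ⟨a, b, ha.1, hb.1, hab, ha.2, hb.2⟩
    · exact ⟨b, a, hb.1, ha.1, hab, hb.2, ha.2⟩

lemma sum_pJoint_left {α β : ℝ} {n : ℕ} (d : Fin (n + 2) → Bool) :
    ∑ x, pJoint α β n (x, d) = pMarkov α β (m := n + 1) d := by
  simp only [pJoint, Finset.sum_const, Finset.card_univ, Fintype.card_pi,
    Fintype.card_bool, Finset.prod_const, Fintype.card_fin, nsmul_eq_mul, Nat.cast_pow,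
    Nat.cast_ofNat]
  rw [← mul_assoc, ← mul_pow]
  norm_num

lemma prob_pMarkov_le {α β : ℝ} (hα : 0 < α) (hα1 : α ≤ 1) (hβ : 0 ≤ β)
    (hβ1 : β ≤ 1)
    {N : ℕ} {E : (Fin (N + 1) → Bool) → Prop} {Q : Bool → Prop}
    {R : Fin N → Bool → Bool → Prop} {c : Fin N → ℝ}
    (hE : ∀ d, E d → Q (d 0) ∧ ∀ t, R t (d t.castSucc) (d t.succ))
    (hc : ∀ t b, ∑ b', (if R t b b' then transD α β b b' else 0) ≤ c t) :
    prob (pMarkov α β) E ≤ (∑ b, if Q b then initD α β b else 0) * ∏ t, c t := by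
  have hq : ∀ b, 0 ≤ if Q b then initD α β b else 0 := by
    intro b
    split_ifs
    exacts [initD_nonneg hα.le hβ b, le_rfl]
  have hw : ∀ t b b', 0 ≤ if R t b b' then transD α β b b' else 0 := by
    intro t b b'
    split_ifs
    exacts [transD_nonneg hα.le hα1 hβ hβ1 b b', le_rfl]
  refine le_trans ?_ (sum_path_le hq hw hc)
  rw [prob_eq_sum_ite]
  refine Finset.sum_le_sum fun d _ => ?_
  by_cases hd : E d
  · obtain ⟨h1, h2⟩ := hE d hd
    rw [if_pos hd, if_pos h1, Finset.prod_congr rfl fun t _ => if_pos (h2 t)]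
    rfl
  · rw [if_neg hd]
    exact mul_nonneg (hq _) (Finset.prod_nonneg fun t _ => hw _ _ _)

lemma sum_pMarkov_le_one {α β : ℝ} (hα : 0 < α) (hα1 : α ≤ 1) (hβ : 0 ≤ β)
    (hβ1 : β ≤ 1)
    {N : ℕ} : ∑ d : Fin (N + 1) → Bool, pMarkov α β d ≤ 1 := by
  refine (sum_path_le (q := initD α β) (w := fun _ => transD α β) (c := fun _ => 1)
    (initD_nonneg hα.le hβ) (fun _ => transD_nonneg hα.le hα1 hβ hβ1)
    (fun _ b => (sum_transD α β b).le)).trans ?_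
  have : 0 < α + β := by linarith
  simp only [Fintype.sum_bool, initD, Finset.prod_const_one, mul_one, if_true]
  simp only [Bool.false_eq_true, if_false]
  rw [← add_div, add_comm β α, div_self this.ne']

/-- A run start costs a factor `β / α`, independently of any later constraints on the steps. -/
lemma prob_runStart_le {α β : ℝ} (hα : 0 < α) (hα1 : α ≤ 1) (hβ : 0 ≤ β)
    (hβ1 : β ≤ 1)
    {N : ℕ} (i : Fin (N + 1)) {R : Fin N → Bool → Bool → Prop}
    {τ : Fin N → ℝ} (hτ0 : ∀ t, 0 ≤ τ t) (hτ1 : ∀ t : Fin N, t.val < i.val → τ t = 1)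
    (hτ : ∀ t b, ∑ b', (if R t b b' then transD α β b b' else 0) ≤ τ t) :
    prob (pMarkov α β) (fun d => RunStart d i ∧ ∀ t : Fin N, R t (d t.castSucc) (d t.succ)) ≤
      β / α * ∏ t, τ t := by
  have hβα : β ≤ β / α := le_div_self hβ hα hα1
  refine (prob_pMarkov_le hα hα1 hβ hβ1 (Q := fun b => i.val = 0 → b = true)
    (R := fun t b b' => (t.val + 1 = i.val → b = false ∧ b' = true) ∧ R t b b')
    (c := fun t => (if t.val + 1 = i.val then β else 1) * τ t) ?_ ?_).trans ?_
  · rintro d ⟨⟨h1, h2⟩, h3⟩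
    refine ⟨fun h0 => ?_, fun t => ⟨fun ht => ?_, h3 t⟩⟩
    · rwa [show (0 : Fin (N + 1)) = i from Fin.ext h0.symm]
    · have hi : i = t.succ := Fin.ext (by simp; omega)
      subst hi
      refine ⟨?_, h1⟩
      rcases h2 with h2 | h2
      · simp at h2
      · exact h2
  · intro t b
    by_cases ht : t.val + 1 = i.val
    · simp only [ht, if_true, true_implies, hτ1 t (by omega), mul_one]
      cases b <;> simp [transD, hβ]
      split_ifs
      exacts [le_rfl, hβ]
    · simp only [ht, if_false, false_implies, true_and, one_mul]
      exact hτ t b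
  · rw [Finset.prod_mul_distrib, ← mul_assoc]
    refine mul_le_mul_of_nonneg_right ?_ (Finset.prod_nonneg fun t _ => hτ0 t)
    have hs : 0 < α + β := by linarith
    refine Fin.cases ?_ (fun t₀ => ?_) i
    · simp [initD]
      exact div_le_div_of_nonneg_left hβ hα (by linarith)
    · rw [Finset.prod_eq_single t₀]
      · simp [initD]
        rw [← add_div, add_comm β α, div_self hs.ne', one_mul]
        exact hβα
      · intro t _ ht
        rw [if_neg]
        intro h
        exact ht (Fin.ext (by simpa using h))
      · simp

lemma prob_two_runStarts_le {α β : ℝ} (hα : 0 < α) (hα1 : α ≤ 1) (hβ : 0 ≤ β)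
    (hβ1 : β ≤ 1)
    {N : ℕ} (i j : Fin (N + 1)) :
    prob (pMarkov α β) (fun d => i < j ∧ RunStart d i ∧ RunStart d j) ≤ β / α * β := by
  by_cases hij : i < j
  swap
  · rw [prob_eq_zero (by tauto)]
    positivity
  obtain ⟨s, rfl⟩ : ∃ s : Fin N, j = s.succ :=
    ⟨j.pred (Fin.ne_of_gt ((Fin.zero_le i).trans_lt hij)), by simp⟩
  have hprod : ∏ t : Fin N, (if t = s then β else 1) = β := by simp
  have h := prob_runStart_le hα hα1 hβ hβ1 i
    (R := fun t b b' => t = s → b = false ∧ b' = true) (τ := fun t => if t = s then β else 1)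
    (fun t => by split_ifs <;> linarith)
    (fun t ht => if_neg (by
      rintro rfl
      rw [Fin.lt_def, Fin.val_succ] at hij
      omega))
    (fun t b => by
      by_cases ht : t = s
      · simp only [ht, if_true, true_implies]
        cases b <;> simp [transD, hβ]
      · simp only [ht, if_false, false_implies, if_true]
        exact (sum_transD α β b).le)
  rw [hprod] at h
  refine (prob_mono (pMarkov_nonneg hα.le hα1 hβ hβ1) fun d hd => ?_).trans h
  refine ⟨hd.2.1, ?_⟩
  rintro t rfl
  obtain ⟨h1, h2⟩ := hd.2.2
  refine ⟨?_, h1⟩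
  rcases h2 with h2 | h2
  · simp at h2
  · exact h2

lemma prob_long_run_le {α β : ℝ} (hα : 0 < α) (hα1 : α ≤ 1) (hβ : 0 ≤ β)
    (hβ1 : β ≤ 1)
    {N L : ℕ} (i : Fin (N + 1)) (hL : i.val + L ≤ N) :
    prob (pMarkov α β) (fun d => RunStart d i ∧
      ∀ t : Fin (N + 1), i ≤ t → t.val ≤ i.val + L → d t = true) ≤
        β / α * (1 - α) ^ L := by
  have hprod : ∏ t : Fin N, (if i.val ≤ t.val ∧ t.val < i.val + L then 1 - α else 1) =
      (1 - α) ^ L := by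
    rw [Fin.prod_univ_eq_prod_range
      (fun t => if i.val ≤ t ∧ t < i.val + L then 1 - α else 1) N, Finset.prod_ite,
      Finset.prod_const, Finset.prod_const_one, mul_one]
    congr 1
    have : (Finset.range N).filter (fun t => i.val ≤ t ∧ t < i.val + L) =
        Finset.Ico i.val (i.val + L) := by
      ext t
      simp only [Finset.mem_filter, Finset.mem_range, Finset.mem_Ico]
      omega
    rw [this, Nat.card_Ico]
    omega
  have h := prob_runStart_le hα hα1 hβ hβ1 i
    (R := fun t b b' => i.val ≤ t.val ∧ t.val < i.val + L → b = true ∧ b' = true)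
    (τ := fun t => if i.val ≤ t.val ∧ t.val < i.val + L then 1 - α else 1)
    (fun t => by split_ifs <;> linarith)
    (fun t ht => if_neg (by omega))
    (fun t b => by
      by_cases ht : i.val ≤ t.val ∧ t.val < i.val + L
      · simp only [ht, and_self, if_true, true_implies]
        cases b <;> simp [transD, hα1]
      · simp only [ht, if_false, false_implies, if_true]
        exact (sum_transD α β b).le)
  rw [hprod] at h
  refine (prob_mono (pMarkov_nonneg hα.le hα1 hβ hβ1) fun d hd => ?_).trans h
  refine ⟨hd.1, fun t ht => ⟨hd.2 _ ?_ ?_, hd.2 _ ?_ ?_⟩⟩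
  · rw [Fin.le_def, Fin.val_castSucc]
    omega
  · rw [Fin.val_castSucc]
    omega
  · rw [Fin.le_def, Fin.val_succ]
    omega
  · rw [Fin.val_succ]
    omega

lemma prob_atypical_le {α β : ℝ} (hα : 0 < α) (hα1 : α ≤ 1) (hβ : 0 ≤ β)
    (hβ1 : β ≤ 1)
    {N m : ℕ} (hm : m ≤ N) (L : ℕ) :
    prob (pMarkov α β) (fun d : Fin (N + 1) → Bool =>
      ¬ (runsCount d m ≤ 1 ∧ onesCount d m ≤ L)) ≤
        (m + 1) ^ 2 * (β / α * β) + (m + 1) * (β / α * (1 - α) ^ L) := by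
  have hp : ∀ d : Fin (N + 1) → Bool, 0 ≤ pMarkov α β d := pMarkov_nonneg hα.le hα1 hβ hβ1
  set I := Finset.univ.filter (fun i : Fin (N + 1) => i.val ≤ m) with hI
  have hmem : ∀ i, i ∈ I ↔ i.val ≤ m := by simp [hI]
  have hcard : (I.card : ℝ) ≤ m + 1 := by
    have hsub : I.image Fin.val ⊆ Finset.range (m + 1) := by
      intro v hv
      obtain ⟨a, ha, rfl⟩ := Finset.mem_image.1 hv
      exact Finset.mem_range.2 (Nat.lt_succ_of_le ((hmem a).1 ha))
    have := Finset.card_le_card hsub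
    rw [Finset.card_image_of_injective _ Fin.val_injective, Finset.card_range] at this
    exact_mod_cast this
  have hα1' : 0 ≤ 1 - α := by linarith
  refine (prob_le_add_prob hp _
    (fun d => ∃ i j : Fin (N + 1), i.val ≤ m ∧ j.val ≤ m ∧ i < j ∧ RunStart d i ∧ RunStart d j)
    (fun d => ∃ i : Fin (N + 1), i.val ≤ m ∧ i.val + L ≤ m ∧ RunStart d i ∧
        ∀ t : Fin (N + 1), i ≤ t → t.val ≤ i.val + L → d t = true)
    fun d hd => exists_of_not_typical d hd).trans (add_le_add ?_ ?_)
  · refine (prob_le_sum_prob hp (I ×ˢ I) _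
      (fun ij d => ij.1 < ij.2 ∧ RunStart d ij.1 ∧ RunStart d ij.2) ?_).trans ?_
    · rintro d ⟨i, j, hi, hj, h⟩
      exact ⟨(i, j), Finset.mem_product.2 ⟨(hmem i).2 hi, (hmem j).2 hj⟩, h⟩
    · refine (Finset.sum_le_card_nsmul _ _ _ fun ij _ =>
        prob_two_runStarts_le hα hα1 hβ hβ1 ij.1 ij.2).trans ?_
      rw [nsmul_eq_mul, Finset.card_product, Nat.cast_mul, ← pow_two]
      gcongr
  · refine (prob_le_sum_prob hp I _
      (fun i d => i.val + L ≤ m ∧ RunStart d i ∧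
        ∀ t : Fin (N + 1), i ≤ t → t.val ≤ i.val + L → d t = true) ?_).trans ?_
    · rintro d ⟨i, hi, h⟩
      exact ⟨i, (hmem i).2 hi, h⟩
    · refine (Finset.sum_le_card_nsmul _ _ (β / α * (1 - α) ^ L) fun i _ => ?_).trans ?_
      · by_cases hiL : i.val + L ≤ m
        · simp only [hiL, true_and]
          exact prob_long_run_le hα hα1 hβ hβ1 i (hiL.trans hm)
        · rw [prob_eq_zero (by tauto)]
          positivity
      · rw [nsmul_eq_mul]
        gcongr

lemma sum_pAtyp_le {α β : ℝ} (hα : 0 < α) (hα1 : α ≤ 1) (hβ : 0 ≤ β)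
    (hβ1 : β ≤ 1)
    {n : ℕ} (hn : mlen α β < n) :
    ∑ ω, pAtyp α β n ω ≤ ((mlen α β : ℝ) + 1) ^ 2 * (β / α * β) + ((mlen α β : ℝ) + 1) *
      (β / α * (1 - α) ^ ⌊(kconst α / 3) * (-Real.logb 2 β)⌋₊) := by
  refine le_trans (le_of_eq ?_) (prob_atypical_le hα hα1 hβ hβ1 (N := n + 1) (by omega) _)
  rw [prob_eq_sum_ite, Fintype.sum_prod_type_right]
  refine Finset.sum_congr rfl fun d _ => ?_
  by_cases hd : Typical α β d
  · refine Eq.trans ?_ (if_neg (not_not.2 hd)).symm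
    simp [pAtyp, hd]
  · refine Eq.trans ?_ (if_pos hd).symm
    simp [pAtyp, hd, sum_pJoint_left]

lemma sum_pTyp_add_sum_pAtyp_le_one {α β : ℝ} (hα : 0 < α) (hα1 : α ≤ 1) (hβ : 0 ≤ β)
    (hβ1 : β ≤ 1)
    (n : ℕ) :
    ∑ ω, pTyp α β n ω + ∑ ω, pAtyp α β n ω ≤ 1 := by
  refine le_trans (le_of_eq ?_) (sum_pMarkov_le_one hα hα1 hβ hβ1 (N := n + 1))
  rw [← Finset.sum_add_distrib, Fintype.sum_prod_type_right]
  refine Finset.sum_congr rfl fun d _ => ?_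
  have h : ∀ x, pTyp α β n (x, d) + pAtyp α β n (x, d) = pJoint α β n (x, d) := by
    intro x
    unfold pTyp pAtyp
    split_ifs <;> simp
  simp only [h]
  exact sum_pJoint_left d

/-! ### Asymptotics as `β → 0` -/

lemma div_add_splitEnt_le_rpow {u v δ : ℝ} (hu : 0 ≤ u) (hv : 0 ≤ v) (huv : u + v ≤ 1)
    (hδ : 0 < δ) (hδ1 : δ < 1) :
    v / Real.log 2 + splitEnt u v ≤ (2 + 1 / δ) / Real.log 2 * v ^ (1 - δ) := by
  have hl : 0 < Real.log 2 := Real.log_pos (by norm_num)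
  have hv1 : v ≤ v ^ (1 - δ) := by
    conv_lhs => rw [← Real.rpow_one v]
    exact Real.rpow_le_rpow_of_exponent_ge' hv (by linarith) (by linarith) (by linarith)
  have h1 : -(u * Real.logb 2 (u / (u + v))) ≤ v / Real.log 2 := by
    simpa using neg_mul_logb_div_le_sub hu (le_add_of_nonneg_right hv)
  have h2 : -(v * Real.logb 2 (v / (u + v))) ≤ 1 / δ / Real.log 2 * v ^ (1 - δ) := by
    rcases hv.eq_or_lt with rfl | hv
    · simp only [zero_mul, neg_zero]
      positivity
    · have hs : 0 < u + v := by linarith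
      have h3 := Real.log_le_rpow_div (div_nonneg hs.le hv.le) hδ
      have h4 : ((u + v) / v) ^ δ ≤ v ^ (-δ) := by
        rw [Real.rpow_neg hv.le, ← Real.inv_rpow hv.le]
        refine Real.rpow_le_rpow (by positivity) ?_ hδ.le
        rw [div_eq_mul_inv]
        exact mul_le_of_le_one_left (by positivity) huv
      have h5 : v ^ (1 - δ) = v * v ^ (-δ) := by
        rw [sub_eq_add_neg, Real.rpow_add hv, Real.rpow_one]
      have h6 : -(v * Real.logb 2 (v / (u + v))) =
          v * Real.log ((u + v) / v) / Real.log 2 := by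
        rw [← inv_div, Real.logb_inv, Real.logb]
        ring
      rw [h6, h5]
      calc v * Real.log ((u + v) / v) / Real.log 2
          ≤ v * (v ^ (-δ) / δ) / Real.log 2 := by
            gcongr
            exact h3.trans (by gcongr)
        _ = _ := by ring
  have h3 : (2 + 1 / δ) / Real.log 2 * v ^ (1 - δ) =
      v ^ (1 - δ) / Real.log 2 + v ^ (1 - δ) / Real.log 2 +
        1 / δ / Real.log 2 * v ^ (1 - δ) := by ring
  have h4 : v / Real.log 2 ≤ v ^ (1 - δ) / Real.log 2 := by gcongr
  unfold splitEnt
  linarith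

lemma kconst_pos (α : ℝ) : 0 < kconst α :=
  lt_of_lt_of_le (by norm_num) (le_max_left _ _)

lemma mlen_add_one_le {α β δ : ℝ} (hβ : 0 < β) (hβ1 : β < 1) (hδ : 0 < δ) :
    (mlen α β : ℝ) + 1 ≤ (kconst α / (Real.log 2 * δ) + 1) * β ^ (-δ) := by
  have hk := kconst_pos α
  have hl : 0 < Real.log 2 := Real.log_pos (by norm_num)
  have hlog : 0 ≤ -Real.logb 2 β := by
    have := Real.logb_nonpos (b := 2) (by norm_num) hβ.le hβ1.le
    linarith
  have h1 : (mlen α β : ℝ) ≤ kconst α * (-Real.logb 2 β) :=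
    Nat.floor_le (mul_nonneg hk.le hlog)
  have h2 : -Real.logb 2 β ≤ β ^ (-δ) / δ / Real.log 2 := by
    have := Real.log_le_rpow_div (inv_nonneg.2 hβ.le) hδ
    rw [Real.log_inv, Real.inv_rpow hβ.le, ← Real.rpow_neg hβ.le] at this
    rw [Real.logb, ← neg_div]
    gcongr
  have h3 : 1 ≤ β ^ (-δ) := Real.one_le_rpow_of_pos_of_le_one_of_nonpos hβ hβ1.le (by linarith)
  have h4 := mul_le_mul_of_nonneg_left h2 hk.le
  have h5 : (kconst α / (Real.log 2 * δ) + 1) * β ^ (-δ) =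
      kconst α * (β ^ (-δ) / δ / Real.log 2) + β ^ (-δ) := by
    field_simp
  linarith

lemma one_sub_pow_floor_le {α β : ℝ} (hα : 0 < α) (hα1 : α < 1) (hβ : 0 < β) (hβ1 : β < 1) :
    (1 - α) ^ ⌊(kconst α / 3) * (-Real.logb 2 β)⌋₊ ≤ β ^ 2 / (1 - α) := by
  have h1α : 0 < 1 - α := by linarith
  have hl : 0 < Real.log 2 := Real.log_pos (by norm_num)
  have hlogα : Real.logb 2 (1 - α) < 0 :=
    Real.logb_neg (by norm_num) h1α (by linarith)
  have hlogβ : Real.logb 2 β < 0 := Real.logb_neg (by norm_num) hβ hβ1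
  have hk : kconst α * Real.logb 2 (1 - α) ≤ -6 := by
    have h := le_max_right 6 (-6 / Real.logb 2 (1 - α))
    exact (div_le_iff_of_neg hlogα).1 h
  have hfloor := Nat.lt_floor_add_one ((kconst α / 3) * (-Real.logb 2 β))
  set L := ⌊(kconst α / 3) * (-Real.logb 2 β)⌋₊
  rw [le_div_iff₀ h1α, ← pow_succ]
  have key : ((L + 1 : ℕ) : ℝ) * Real.logb 2 (1 - α) ≤ 2 * Real.logb 2 β := by
    have h1 := mul_le_mul_of_nonpos_right hfloor.le hlogα.le
    have h2 := mul_le_mul_of_nonneg_right hk (neg_pos.2 hlogβ).le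
    push_cast
    nlinarith
  rw [← Real.logb_le_logb (b := 2) (by norm_num) (by positivity) (by positivity),
    Real.logb_pow, Real.logb_pow]
  exact_mod_cast key

lemma exists_sum_pAtyp_le {α δ : ℝ} (hα : 0 < α) (hα1 : α < 1) (hδ : 0 < δ) :
    ∃ C : ℝ, 0 < C ∧ ∀ β : ℝ, 0 < β → β < 1 → ∀ n : ℕ, mlen α β < n →
      ∑ ω, pAtyp α β n ω ≤ C * β ^ (2 - 2 * δ) := by
  have hk := kconst_pos α
  have hl : 0 < Real.log 2 := Real.log_pos (by norm_num)
  have h1α : 0 < 1 - α := by linarith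
  set M := kconst α / (Real.log 2 * δ) + 1 with hM
  have hM0 : 0 < M := by positivity
  refine ⟨M ^ 2 / α + M / (α * (1 - α)), by positivity, fun β hβ hβ1 n hn => ?_⟩
  refine (sum_pAtyp_le hα hα1.le hβ.le hβ1.le hn).trans ?_
  have hm := mlen_add_one_le (α := α) hβ hβ1 hδ
  have hpow := one_sub_pow_floor_le hα hα1 hβ hβ1
  rw [← hM] at hm
  have e1 : β ^ (2 - 2 * δ) = β ^ 2 * (β ^ (-δ)) ^ 2 := by
    rw [← Real.rpow_natCast, ← Real.rpow_natCast, ← Real.rpow_mul hβ.le, ← Real.rpow_add hβ]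
    congr 1
    push_cast
    ring
  have e2 : 1 ≤ β ^ (-δ) := Real.one_le_rpow_of_pos_of_le_one_of_nonpos hβ hβ1.le (by linarith)
  set x := β ^ (-δ)
  rw [e1]
  calc ((mlen α β : ℝ) + 1) ^ 2 * (β / α * β) + ((mlen α β : ℝ) + 1) *
        (β / α * (1 - α) ^ ⌊(kconst α / 3) * (-Real.logb 2 β)⌋₊)
      ≤ (M * x) ^ 2 * (β / α * β) + (M * x) * (β / α * (β ^ 2 / (1 - α))) := by gcongr
    _ = M ^ 2 / α * (β ^ 2 * x ^ 2) + M / (α * (1 - α)) * (β ^ 2 * (β * x)) := by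
        field_simp
    _ ≤ M ^ 2 / α * (β ^ 2 * x ^ 2) + M / (α * (1 - α)) * (β ^ 2 * x ^ 2) := by
        have : β * x ≤ x ^ 2 := by nlinarith
        gcongr
    _ = _ := by ring

lemma exists_Eseq_sub_EseqTyp_le {α ε : ℝ} (hα : 0 < α) (hα1 : α < 1) (hε : 0 < ε) :
    ∃ K : ℝ, 0 < K ∧ ∀ β : ℝ, 0 < β → β < 1 → ∀ n : ℕ, mlen α β < n →
      Eseq α β n - EseqTyp α β n ≤ K * β ^ (2 - ε) := by
  have hl : 0 < Real.log 2 := Real.log_pos (by norm_num)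
  obtain ⟨δ, hδ, hδ1, hδε⟩ : ∃ δ : ℝ, 0 < δ ∧ δ < 1 ∧ 4 * δ ≤ ε :=
    ⟨min ε 1 / 4, by positivity, by linarith [min_le_right ε 1], by linarith [min_le_left ε 1]⟩
  obtain ⟨C, hC, hCβ⟩ := exists_sum_pAtyp_le hα hα1 hδ
  refine ⟨(2 + 1 / δ) / Real.log 2 * C ^ (1 - δ), by positivity, fun β hβ hβ1 n hn => ?_⟩
  have hq0 : 0 ≤ ∑ ω, pAtyp α β n ω :=
    Finset.sum_nonneg fun ω _ => pAtyp_nonneg hα.le hα1.le hβ.le hβ1.le ω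
  have hp0 : 0 ≤ ∑ ω, pTyp α β n ω :=
    Finset.sum_nonneg fun ω _ => pTyp_nonneg hα.le hα1.le hβ.le hβ1.le ω
  refine (Eseq_sub_EseqTyp_le hα.le hα1.le hβ.le hβ1.le n).trans
    ((div_add_splitEnt_le_rpow hp0 hq0
      (sum_pTyp_add_sum_pAtyp_le_one hα hα1.le hβ.le hβ1.le n) hδ hδ1).trans ?_)
  rw [mul_assoc]
  refine mul_le_mul_of_nonneg_left ?_ (by positivity)
  refine (Real.rpow_le_rpow hq0 (hCβ β hβ hβ1 n hn) (by linarith)).trans ?_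
  rw [Real.mul_rpow hC.le (by positivity), ← Real.rpow_mul hβ.le]
  refine mul_le_mul_of_nonneg_left ?_ (by positivity)
  exact Real.rpow_le_rpow_of_exponent_ge hβ hβ1.le (by nlinarith)

lemma exists_tendsto_of_le_succ {u : ℕ → ℝ} {N : ℕ} {b : ℝ}
    (hu : ∀ n, N < n → u n ≤ u (n + 1)) (hb : ∀ n, u n ≤ b) :
    ∃ l, Tendsto u atTop (nhds l) := by
  have hmono : Monotone (fun n => u (n + (N + 1))) := monotone_nat_of_le_succ fun n => by
    rw [show n + 1 + (N + 1) = n + (N + 1) + 1 by ring]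
    exact hu _ (by omega)
  refine ⟨_, (tendsto_add_atTop_iff_nat (N + 1)).1 (tendsto_atTop_ciSup hmono ⟨b, ?_⟩)⟩
  rintro _ ⟨n, rfl⟩
  exact hb _

lemma Eseq_le {α β : ℝ} (hα : 0 < α) (hα1 : α ≤ 1) (hβ : 0 ≤ β) (hβ1 : β ≤ 1) (n : ℕ) :
    Eseq α β n ≤ 1 / Real.log 2 := by
  have hl : 0 < Real.log 2 := Real.log_pos (by norm_num)
  rw [Eseq_eq]
  refine (condEnt_le (fun ω => add_nonneg (pTyp_nonneg hα.le hα1 hβ hβ1 ω)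
    (pAtyp_nonneg hα.le hα1 hβ hβ1 ω)) _ _).trans ?_
  rw [Finset.sum_add_distrib]
  gcongr
  exact sum_pTyp_add_sum_pAtyp_le_one hα hα1 hβ hβ1 n

/-- Fix `α ∈ (0,1)`. For every `ε > 0` there are `K > 0`, `β₀ > 0` such
that for all `β ∈ (0, β₀)` and all `n > m`:
`0 ≤ E_n − H(D_1 | X^n, y(X^n,D^n), D_0, D_{n+1}, T=1) P(T=1) ≤ K β^{2−ε}`;
consequently `E_∞ = lim_n H(D_1 | X^n, y(X^n,D^n), D_0, D_{n+1}, T=1) P(T=1) + O(β^{2−ε})`. -/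
theorem focus_on_typical (α : ℝ) (hα : 0 < α ∧ α < 1) (ε : ℝ) (hε : 0 < ε) :
    ∃ K : ℝ, 0 < K ∧ ∃ β₀ : ℝ, 0 < β₀ ∧ ∀ β : ℝ, 0 < β → β < β₀ →
      (∀ n : ℕ, mlen α β < n →
        0 ≤ Eseq α β n - EseqTyp α β n ∧
          Eseq α β n - EseqTyp α β n ≤ K * β ^ ((2 : ℝ) - ε)) ∧
      ∃ Einf L : ℝ,
        Tendsto (fun n : ℕ => Eseq α β n) atTop (nhds Einf) ∧
        Tendsto (fun n : ℕ => EseqTyp α β n) atTop (nhds L) ∧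
        |Einf - L| ≤ K * β ^ ((2 : ℝ) - ε) := by
  obtain ⟨hα0, hα1⟩ := hα
  obtain ⟨K, hK, hbound⟩ := exists_Eseq_sub_EseqTyp_le hα0 hα1 hε
  refine ⟨K, hK, 1, one_pos, fun β hβ hβ1 => ?_⟩
  have hlow : ∀ n, EseqTyp α β n ≤ Eseq α β n :=
    EseqTyp_le_Eseq hα0.le hα1.le hβ.le hβ1.le
  refine ⟨fun n hn => ⟨sub_nonneg.2 (hlow n), hbound β hβ hβ1 n hn⟩, ?_⟩
  have hE := Eseq_le hα0 hα1.le hβ.le hβ1.le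
  obtain ⟨Einf, hEinf⟩ := exists_tendsto_of_le_succ (u := Eseq α β) (N := 0)
    (fun n _ => Eseq_le_succ hα0.le hα1.le hβ.le hβ1.le n) hE
  obtain ⟨L, hL⟩ := exists_tendsto_of_le_succ (u := EseqTyp α β) (N := mlen α β)
    (fun n hn => EseqTyp_le_succ hα0.le hα1.le hβ.le hβ1.le hn)
    (fun n => (hlow n).trans (hE n))
  refine ⟨Einf, L, hEinf, hL, ?_⟩
  rw [abs_of_nonneg (sub_nonneg.2 (le_of_tendsto_of_tendsto' hL hEinf hlow))]
  refine le_of_tendsto (hEinf.sub hL) ?_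
  filter_upwards [eventually_gt_atTop (mlen α β)] with n hn
  exact hbound β hβ hβ1 n hn
end SyncDeletion
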